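/- The ring of integer-valued arithmetic functions under pointwise addition and Dirichlet convolution is a unique factorization domain: every nonzero element can be written as a unit times a finite product of irreducible elements, and this representation is unique up to the order of the factors and replacement of factors by associates. -/

import Mathlib

namespace MvPowerSeries

variable {σ R : Type*} [CommRing R]

/-- The power series whose coefficients of degree `d` are divisible by `a ^ (k - d)`. -/
def adicIdeal (σ : Type*) (a : R) (k : ℕ) : Ideal (MvPowerSeries σ R) where
  carrier := {f | ∀ e, a ^ (k - e.degree) ∣ coeff e f}
  zero_mem' := by simp
  add_mem' hf hg e := by
    rw [map_add]
    exact dvd_add (hf e) (hg e)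
  smul_mem' c f hf e := by
    classical
    rw [smul_eq_mul, coeff_mul]
    refine Finset.dvd_sum fun x hx ↦ Dvd.dvd.mul_left ((pow_dvd_pow a ?_).trans (hf x.2)) _
    have := congrArg Finsupp.degree (Finset.HasAntidiagonal.mem_antidiagonal.1 hx)
    rw [map_add] at this
    omega

theorem mem_adicIdeal {a : R} {k : ℕ} {f : MvPowerSeries σ R} :
    f ∈ adicIdeal σ a k ↔ ∀ e, a ^ (k - e.degree) ∣ coeff e f := Iff.rfl

theorem adicIdeal_zero (a : R) : adicIdeal σ a 0 = ⊤ := by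
  rw [Ideal.eq_top_iff_one, mem_adicIdeal]
  simp

theorem mem_adicIdeal_one {a : R} {f : MvPowerSeries σ R} :
    f ∈ adicIdeal σ a 1 ↔ a ∣ constantCoeff f := by
  rw [mem_adicIdeal]
  constructor
  · intro h
    simpa using h 0
  · intro h e
    rcases eq_or_ne e 0 with rfl | he
    · simpa using h
    · have : e.degree ≠ 0 := by simpa [Finsupp.degree_eq_zero_iff] using he
      rw [Nat.sub_eq_zero_of_le (by omega), pow_zero]
      exact one_dvd _

theorem adicIdeal_mul_le (a : R) (j k : ℕ) :
    adicIdeal σ a j * adicIdeal σ a k ≤ adicIdeal σ a (j + k) := by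
  classical
  rw [Ideal.mul_le]
  intro f hf g hg e
  rw [coeff_mul]
  refine Finset.dvd_sum fun x hx ↦ ?_
  refine (pow_dvd_pow a ?_).trans ((pow_add a _ _).dvd.trans (mul_dvd_mul (hf x.1) (hg x.2)))
  have := congrArg Finsupp.degree (Finset.HasAntidiagonal.mem_antidiagonal.1 hx)
  rw [map_add] at this
  omega

theorem adicIdeal_succ_le [Finite σ] (a : R) (k : ℕ) :
    adicIdeal σ a (k + 1) ≤ adicIdeal σ a 1 * adicIdeal σ a k := by
  classical
  have := Fintype.ofFinite σ
  intro f hf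
  have hex : ∀ e : σ →₀ ℕ, e ≠ 0 → ∃ i, e i ≠ 0 := fun e he ↦ Finsupp.ne_iff.1 he
  choose c hc using hex
  let g : σ → MvPowerSeries σ R := fun i e ↦
    if h : e + Finsupp.single i 1 ≠ 0 then
      if c _ h = i then coeff (e + Finsupp.single i 1) f else 0
    else 0
  have hg (i : σ) (e : σ →₀ ℕ) : coeff e (g i) =
      if h : e + Finsupp.single i 1 ≠ 0 then
        if c _ h = i then coeff (e + Finsupp.single i 1) f else 0
      else 0 := rfl
  have hgJ (i : σ) : g i ∈ adicIdeal σ a k := by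
    intro e
    rw [hg]
    split_ifs
    · have := hf (e + Finsupp.single i 1)
      rwa [map_add, Finsupp.degree_single, Nat.add_sub_add_right] at this
    · exact dvd_zero _
    · exact dvd_zero _
  have key : f = C (constantCoeff f) + ∑ i, X i * g i := by
    ext e
    rw [map_add, map_sum]
    rcases eq_or_ne e 0 with rfl | he
    · simp
    · rw [coeff_C, if_neg he, zero_add, Finset.sum_eq_single (c e he)]
      · have hle : Finsupp.single (c e he) 1 ≤ e := by
          rw [Finsupp.single_le_iff]
          have := hc e he
          omega
        rw [X, coeff_monomial_mul, if_pos hle, one_mul, hg]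
        simp only [tsub_add_cancel_of_le hle]
        simp [he]
      · intro i _ hi
        rw [X, coeff_monomial_mul]
        split_ifs with hle
        · rw [hg]
          simp only [tsub_add_cancel_of_le hle]
          rw [dif_pos he, if_neg (Ne.symm hi), mul_zero]
        · rfl
      · simp
  rw [key]
  refine add_mem ?_ (sum_mem fun i _ ↦ Ideal.mul_mem_mul ?_ (hgJ i))
  · have h0 := hf 0
    rw [map_zero, Nat.sub_zero, coeff_zero_eq_constantCoeff_apply] at h0
    obtain ⟨b, hb⟩ := h0
    rw [hb, pow_succ', mul_assoc, map_mul]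
    refine Ideal.mul_mem_mul (mem_adicIdeal_one.2 (by simp)) fun e ↦ ?_
    rw [coeff_C]
    split_ifs with he
    · rw [he, map_zero, Nat.sub_zero]
      exact dvd_mul_right _ _
    · exact dvd_zero _
  · exact mem_adicIdeal_one.2 (by simp)

theorem adicIdeal_one_pow [Finite σ] (a : R) (k : ℕ) :
    adicIdeal σ a 1 ^ k = adicIdeal σ a k := by
  induction k with
  | zero => rw [pow_zero, adicIdeal_zero, Ideal.one_eq_top]
  | succ k ih =>
    rw [pow_succ', ih]
    exact le_antisymm ((adicIdeal_mul_le a 1 k).trans_eq (by rw [add_comm]))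
      (adicIdeal_succ_le a k)

theorem isPrecomplete_adicIdeal_one [Finite σ] (a : R) [IsPrecomplete (Ideal.span {a}) R] :
    IsPrecomplete (adicIdeal σ a 1) (MvPowerSeries σ R) := by
  constructor
  intro f hf
  have hf' {m n : ℕ} (h : m ≤ n) (e : σ →₀ ℕ) :
      a ^ (m - e.degree) ∣ coeff e (f m) - coeff e (f n) := by
    have := hf h
    rw [SModEq.sub_mem, smul_eq_mul, Ideal.mul_top, adicIdeal_one_pow] at this
    simpa using this e
  have hlim (e : σ →₀ ℕ) : ∃ l : R, ∀ n, a ^ n ∣ coeff e (f (n + e.degree)) - l := by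
    obtain ⟨l, hl⟩ := IsPrecomplete.prec (I := Ideal.span {a}) (M := R) inferInstance
      (f := fun n ↦ coeff e (f (n + e.degree))) (by
        intro m n h
        rw [SModEq.sub_mem, smul_eq_mul, Ideal.mul_top, Ideal.span_singleton_pow,
          Ideal.mem_span_singleton]
        simpa using hf' (Nat.add_le_add_right h e.degree) e)
    refine ⟨l, fun n ↦ ?_⟩
    have := hl n
    rwa [SModEq.sub_mem, smul_eq_mul, Ideal.mul_top, Ideal.span_singleton_pow,
      Ideal.mem_span_singleton] at this
  choose l hl using hlim
  let L : MvPowerSeries σ R := fun e ↦ l e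
  refine ⟨L, fun n ↦ ?_⟩
  rw [SModEq.sub_mem, smul_eq_mul, Ideal.mul_top, adicIdeal_one_pow]
  intro e
  rw [map_sub]
  change _ ∣ coeff e (f n) - l e
  have h1 := hf' (Nat.le_add_right n e.degree) e
  have h2 := (pow_dvd_pow a (Nat.sub_le n e.degree)).trans (hl e n)
  simpa using dvd_add h1 h2

theorem maximalIdeal_eq_adicIdeal [IsLocalRing R] {a : R}
    (ha : IsLocalRing.maximalIdeal R = Ideal.span {a}) :
    IsLocalRing.maximalIdeal (MvPowerSeries σ R) = adicIdeal σ a 1 := by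
  ext f
  rw [mem_adicIdeal_one, ← Ideal.mem_span_singleton, ← ha, IsLocalRing.mem_maximalIdeal,
    IsLocalRing.mem_maximalIdeal, mem_nonunits_iff, mem_nonunits_iff, isUnit_iff_constantCoeff]

theorem isAdicComplete_maximalIdeal [Finite σ] [IsLocalRing R] [IsNoetherianRing R]
    [IsAdicComplete (IsLocalRing.maximalIdeal R) R] {a : R}
    (ha : IsLocalRing.maximalIdeal R = Ideal.span {a}) :
    IsAdicComplete (IsLocalRing.maximalIdeal (MvPowerSeries σ R)) (MvPowerSeries σ R) := by
  have : IsPrecomplete (Ideal.span {a}) R := ha ▸ inferInstance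
  have := isPrecomplete_adicIdeal_one (σ := σ) a
  rw [← maximalIdeal_eq_adicIdeal ha] at this
  exact { }

theorem C_dvd_iff {a : R} {f : MvPowerSeries σ R} : C a ∣ f ↔ ∀ e, a ∣ coeff e f := by
  constructor
  · rintro ⟨g, rfl⟩ e
    exact ⟨coeff e g, coeff_C_mul _ _ _⟩
  · intro h
    choose g hg using h
    let G : MvPowerSeries σ R := fun e ↦ g e
    refine ⟨G, ?_⟩
    ext e
    rw [coeff_C_mul, hg]
    rfl

theorem prime_C [IsDomain R] {a : R} (ha : Prime a) : Prime (C a : MvPowerSeries σ R) := by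
  have hP : (Ideal.span {a}).IsPrime := (Ideal.span_singleton_prime ha.ne_zero).2 ha
  have hdvd (f : MvPowerSeries σ R) :
      C a ∣ f ↔ map (Ideal.Quotient.mk (Ideal.span {a})) f = 0 := by
    simp_rw [C_dvd_iff, MvPowerSeries.ext_iff, coeff_map, map_zero, Ideal.Quotient.eq_zero_iff_mem,
      Ideal.mem_span_singleton]
  refine ⟨?_, ?_, fun f g h ↦ ?_⟩
  · rw [Ne, ← map_zero C, C_injective.eq_iff]
    exact ha.ne_zero
  · intro h
    exact ha.not_isUnit (by simpa [isUnit_iff_constantCoeff] using h)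
  · rwa [hdvd, map_mul, mul_eq_zero, ← hdvd, ← hdvd] at h

end MvPowerSeries

theorem exists_weight_isMin (n : ℕ) (T : Set (Fin (n + 1) → ℕ)) (hT : T.Nonempty) :
    ∃ w : Fin (n + 1) → ℕ, w 0 = 1 ∧ (∀ i, w i ≠ 0) ∧
      ∃ e ∈ T, ∀ e' ∈ T, e' ≠ e → ∑ i, w i * e i < ∑ i, w i * e' i := by
  induction n with
  | zero =>
    refine ⟨fun _ ↦ 1, rfl, fun _ ↦ one_ne_zero, ?_⟩
    obtain ⟨e, he, hmin⟩ := WellFounded.has_min (measure fun e : Fin 1 → ℕ ↦ e 0).wf T hT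
    refine ⟨e, he, fun e' he' hne ↦ ?_⟩
    have h1 : ¬ e' 0 < e 0 := hmin e' he'
    have h2 : e' 0 ≠ e 0 := fun h ↦ hne (funext fun i ↦ by rwa [Fin.fin_one_eq_zero i])
    simp
    omega
  | succ n ih =>
    obtain ⟨e₀, he₀, hmin⟩ :=
      WellFounded.has_min (measure fun e : Fin (n + 2) → ℕ ↦ e (Fin.last _)).wf T hT
    obtain ⟨w, hw0, hw, d, hd, hdmin⟩ :=
      ih {d | (Fin.snoc d (e₀ (Fin.last _)) : Fin (n + 2) → ℕ) ∈ T}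
        ⟨Fin.init e₀, by simpa using he₀⟩
    refine ⟨Fin.snoc w (∑ i, w i * d i + 1), ?_, ?_, Fin.snoc d (e₀ (Fin.last _)), hd, ?_⟩
    · rw [← Fin.castSucc_zero, Fin.snoc_castSucc, hw0]
    · intro i
      induction i using Fin.lastCases with
      | last => simp
      | cast i => simpa using hw i
    · intro e' he' hne
      have h1 : e₀ (Fin.last _) ≤ e' (Fin.last _) := not_lt.1 (hmin e' he')
      rw [Fin.sum_univ_castSucc, Fin.sum_univ_castSucc (n := n + 1)]
      simp only [Fin.snoc_castSucc, Fin.snoc_last]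
      rcases h1.eq_or_lt with h | h
      · rw [h]
        have he'' : (Fin.snoc (Fin.init e') (e' (Fin.last _)) : Fin (n + 2) → ℕ) = e' :=
          Fin.snoc_init_self e'
        have := hdmin (Fin.init e') (by rw [Set.mem_ofPred_eq, h, he'']; exact he')
          (fun h' ↦ hne (by rw [← he'', h', h]))
        simpa [Fin.init] using this
      · nlinarith [Nat.mul_le_mul_left (∑ i, w i * d i + 1) (Nat.succ_le_of_lt h),
          Nat.zero_le (∑ i : Fin (n + 1), w i * e' i.castSucc)]

namespace MvPowerSeries

variable {R : Type*} [CommRing R] {n : ℕ}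

theorem hasSubst_cons_X_add (s : Fin n → MvPowerSeries (Fin (n + 1)) R)
    (hs : ∀ i, constantCoeff (s i) = 0) :
    HasSubst (Fin.cons (X 0) fun i ↦ X i.succ + s i : Fin (n + 1) → MvPowerSeries _ R) := by
  refine hasSubst_of_constantCoeff_zero fun i ↦ ?_
  induction i using Fin.cases with
  | zero => simp
  | succ i => simp [hs]

theorem subst_cons_X_add_subst_of_add_eq_zero {s t : Fin n → MvPowerSeries (Fin (n + 1)) R}
    (hs : ∀ i, constantCoeff (s i) = 0) (ht : ∀ i, constantCoeff (t i) = 0)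
    (hst : ∀ i, t i + subst (Fin.cons (X 0) fun i ↦ X i.succ + t i :
      Fin (n + 1) → MvPowerSeries _ R) (s i) = 0) (f : MvPowerSeries (Fin (n + 1)) R) :
    subst (Fin.cons (X 0) fun i ↦ X i.succ + t i : Fin (n + 1) → MvPowerSeries _ R)
      (subst (Fin.cons (X 0) fun i ↦ X i.succ + s i : Fin (n + 1) → MvPowerSeries _ R) f) = f := by
  have h₁ := hasSubst_cons_X_add s hs
  have h₂ := hasSubst_cons_X_add t ht
  rw [subst_comp_subst_apply h₁ h₂]
  have hX : (fun i ↦ subst (Fin.cons (X 0) fun i ↦ X i.succ + t i :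
      Fin (n + 1) → MvPowerSeries _ R) ((Fin.cons (X 0) fun i ↦ X i.succ + s i :
      Fin (n + 1) → MvPowerSeries _ R) i)) = X := by
    funext i
    induction i using Fin.cases with
    | zero => rw [Fin.cons_zero, subst_X h₂, Fin.cons_zero]
    | succ i =>
      rw [Fin.cons_succ, subst_add h₂, subst_X h₂, Fin.cons_succ, add_assoc, hst, add_zero]
  rw [hX, subst_self, id]

/-- The automorphism fixing the first variable `X 0` and translating each other variable `X (i + 1)`
by a positive power of `X 0`. -/
noncomputable def shear (d : Fin n → ℕ) (hd : ∀ i, d i ≠ 0) :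
    MvPowerSeries (Fin (n + 1)) R ≃+* MvPowerSeries (Fin (n + 1)) R :=
  have hs (i : Fin n) : constantCoeff (X 0 ^ d i : MvPowerSeries (Fin (n + 1)) R) = 0 := by
    simp [hd]
  have ht (i : Fin n) : constantCoeff (-X 0 ^ d i : MvPowerSeries (Fin (n + 1)) R) = 0 := by
    simp [hd]
  have h₁ := hasSubst_cons_X_add _ hs
  have h₂ := hasSubst_cons_X_add _ ht
  RingEquiv.ofRingHom (substAlgHom (R := R) h₁).toRingHom (substAlgHom (R := R) h₂).toRingHom
    (RingHom.ext fun f ↦ by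
      simp only [AlgHom.toRingHom_eq_coe, RingHom.coe_comp, RingHom.coe_coe, Function.comp_apply,
        substAlgHom_apply, RingHom.id_apply]
      refine subst_cons_X_add_subst_of_add_eq_zero ht hs (fun i ↦ ?_) f
      rw [← substAlgHom_apply h₁, map_neg, map_pow, substAlgHom_X, Fin.cons_zero, add_neg_cancel])
    (RingHom.ext fun f ↦ by
      simp only [AlgHom.toRingHom_eq_coe, RingHom.coe_comp, RingHom.coe_coe, Function.comp_apply,
        substAlgHom_apply, RingHom.id_apply]
      refine subst_cons_X_add_subst_of_add_eq_zero hs ht (fun i ↦ ?_) f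
      rw [← substAlgHom_apply h₂, map_pow, substAlgHom_X, Fin.cons_zero, neg_add_cancel])

theorem constantCoeff_coeff_finSuccEquiv_prod (d : Fin n → ℕ) (e : Fin (n + 1) →₀ ℕ) (j : ℕ) :
    constantCoeff (PowerSeries.coeff j (finSuccEquiv R n (e.prod fun i k ↦
      (Fin.cons (X 0) (fun i ↦ X i.succ + X 0 ^ d i) : Fin (n + 1) → MvPowerSeries _ R) i ^ k))) =
    if j = ∑ i, (Fin.cons 1 d : Fin (n + 1) → ℕ) i * e i then 1 else 0 := by
  let ψ : MvPowerSeries (Fin (n + 1)) R →+* PowerSeries R :=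
    (PowerSeries.map constantCoeff).comp (finSuccEquiv R n).toRingEquiv.toRingHom
  have hψ (f) : constantCoeff (PowerSeries.coeff j (finSuccEquiv R n f)) =
      PowerSeries.coeff j (ψ f) := by
    simp [ψ]
  have hX (i : Fin (n + 1)) : ψ ((Fin.cons (X 0) (fun i ↦ X i.succ + X 0 ^ d i) :
      Fin (n + 1) → MvPowerSeries _ R) i) =
      PowerSeries.X ^ (Fin.cons 1 d : Fin (n + 1) → ℕ) i := by
    induction i using Fin.cases with
    | zero => simp [ψ, finSuccEquiv_X_zero]
    | succ i => simp [ψ, finSuccEquiv_X_zero, finSuccEquiv_X_succ]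
  rw [hψ, Finsupp.prod_fintype _ _ (by simp), map_prod]
  simp_rw [map_pow, hX, ← pow_mul]
  rw [Finset.prod_pow_eq_pow_sum, PowerSeries.coeff_X_pow]

theorem exists_shear_notMem (P : Ideal R) (f : MvPowerSeries (Fin (n + 1)) R)
    {e₀ : Fin (n + 1) →₀ ℕ} (he₀ : coeff e₀ f ∉ P) : ∃ (d : Fin n → ℕ) (hd : ∀ i, d i ≠ 0) (j : ℕ),
      constantCoeff (PowerSeries.coeff j (finSuccEquiv R n (shear d hd f))) ∉ P := by
  obtain ⟨w, hw0, hw, e, he, hmin⟩ := exists_weight_isMin n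
    {e | coeff (Finsupp.equivFunOnFinite.symm e) f ∉ P} ⟨e₀, by simpa using he₀⟩
  refine ⟨Fin.tail w, fun i ↦ hw _, ∑ i, w i * e i, ?_⟩
  have hcons : (Fin.cons 1 (Fin.tail w) : Fin (n + 1) → ℕ) = w := by
    simpa [hw0] using Fin.cons_self_tail w
  have h₁ := hasSubst_cons_X_add (R := R) (fun i ↦ X 0 ^ Fin.tail w i)
    (by simp [Fin.tail, hw])
  rw [← coeff_zero_eq_constantCoeff_apply, coeff_coeff_finSuccEquiv]
  change coeff _ (substAlgHom h₁ f) ∉ P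
  rw [substAlgHom_apply, coeff_subst h₁]
  have hfin := coeff_subst_finite h₁ f ((0 : Fin n →₀ ℕ).cons (∑ i, w i * e i))
  simp_rw [← coeff_coeff_finSuccEquiv, coeff_zero_eq_constantCoeff_apply,
    constantCoeff_coeff_finSuccEquiv_prod, hcons, smul_eq_mul] at hfin ⊢
  rw [finsum_eq_sum _ hfin]
  set S := hfin.toFinset
  have heS : Finsupp.equivFunOnFinite.symm e ∈ S := by
    refine (Set.Finite.mem_toFinset hfin).2 fun h ↦ ?_
    simp only [Finsupp.equivFunOnFinite_symm_apply_apply, if_true, mul_one] at h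
    exact he (by rw [h]; exact P.zero_mem)
  rw [← Finset.add_sum_erase _ _ heS]
  intro hmem
  refine he ?_
  have hrest : ∑ x ∈ S.erase (Finsupp.equivFunOnFinite.symm e),
      (coeff x f * if ∑ i, w i * e i = ∑ i, w i * x i then 1 else 0) ∈ P := by
    refine sum_mem fun x hx ↦ ?_
    split_ifs with hwx
    · rw [mul_one]
      by_contra hxP
      have hne : (x : Fin (n + 1) → ℕ) ≠ e := by
        rintro rfl
        simp at hx
      exact absurd hwx (hmin x (by simpa using hxP) hne).ne
    · rw [mul_zero]
      exact P.zero_mem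
  simpa using (P.add_mem_iff_left hrest).1 hmem

end MvPowerSeries

namespace PowerSeries

open IsLocalRing Polynomial

variable {S : Type*} [CommRing S] [IsLocalRing S]

theorem isDistinguishedAt_of_dvd {q r : S[X]} (hq : q.IsDistinguishedAt (maximalIdeal S))
    (hr : r.Monic) (hrq : r ∣ q) : r.IsDistinguishedAt (maximalIdeal S) := by
  have hdvd : r.map (residue S) ∣ Polynomial.X ^ q.natDegree := by
    rw [← show q.map (residue S) = Polynomial.X ^ q.natDegree from hq.map_eq_X_pow]
    exact Polynomial.map_dvd _ hrq
  obtain ⟨k, -, hk⟩ := (dvd_prime_pow Polynomial.prime_X _).1 hdvd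
  have hX : r.map (residue S) = Polynomial.X ^ k :=
    eq_of_monic_of_associated (hr.map _) (monic_X_pow k) hk
  have hdeg : r.natDegree = k := by
    rw [← hr.natDegree_map (residue S), hX, natDegree_X_pow]
  refine ⟨⟨fun {i} hi ↦ ?_⟩, hr⟩
  rw [← residue_eq_zero_iff, ← Polynomial.coeff_map, hX, Polynomial.coeff_X_pow, if_neg (by omega)]

variable [IsAdicComplete (maximalIdeal S) S]

theorem prime_coe_of_isDistinguishedAt {r : S[X]} (hr : r.IsDistinguishedAt (maximalIdeal S))
    (hp : Prime r) : Prime (r : S⟦X⟧) := by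
  have h0 : (r : S⟦X⟧) ≠ 0 := by
    simpa using hp.ne_zero
  rw [← Ideal.span_singleton_prime h0, ← Ideal.Quotient.isDomain_iff_prime]
  have : IsDomain (S[X] ⧸ Ideal.span {r}) :=
    (Ideal.Quotient.isDomain_iff_prime _).2 ((Ideal.span_singleton_prime hp.ne_zero).2 hp)
  exact (hr.algEquivQuotient).symm.toMulEquiv.isDomain

theorem exists_prime_mem_of_map_residue_ne_zero [IsDomain S] [UniqueFactorizationMonoid S]
    (P : Ideal S⟦X⟧) [P.IsPrime] {g : S⟦X⟧} (hg : g ∈ P) (hg0 : g.map (residue S) ≠ 0) :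
    ∃ r ∈ P, Prime r := by
  obtain ⟨q, h, H⟩ := exists_isWeierstrassFactorization hg0
  have hq : (q : S⟦X⟧) ∈ P := by
    rw [H.eq_mul] at hg
    exact (Ideal.IsPrime.mem_or_mem ‹_› hg).resolve_right fun h' ↦
      Ideal.IsPrime.ne_top ‹_› (P.eq_top_of_isUnit_mem h' H.isUnit)
  have hqm := H.isDistinguishedAt.monic
  obtain ⟨r, hr, hrP⟩ : ∃ r ∈ UniqueFactorizationMonoid.factors q, (r : S⟦X⟧) ∈ P := by
    have h1 := (UniqueFactorizationMonoid.factors_prod hqm.ne_zero).symm.dvd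
    have h2 : (UniqueFactorizationMonoid.factors q).prod ∈
        P.comap (coeToPowerSeries.ringHom (R := S)) := by
      obtain ⟨u, hu⟩ := (UniqueFactorizationMonoid.factors_prod hqm.ne_zero).symm
      rw [← hu]
      exact Ideal.mul_mem_right _ _ hq
    obtain ⟨r, hr, hrP⟩ := (Ideal.IsPrime.multiset_prod_mem_iff_exists_mem inferInstance _).1 h2
    exact ⟨r, hr, hrP⟩
  have hrp := UniqueFactorizationMonoid.prime_of_factor r hr
  obtain ⟨s, hs⟩ := UniqueFactorizationMonoid.dvd_of_mem_factors hr
  have hu : IsUnit r.leadingCoeff := by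
    refine IsUnit.of_mul_eq_one s.leadingCoeff ?_
    rw [← leadingCoeff_mul, ← hs, hqm.leadingCoeff]
  obtain ⟨u, hu⟩ := hu
  have hassoc : Associated r (r * Polynomial.C (↑u⁻¹ : S)) :=
    ⟨Units.map (Polynomial.C : S →+* S[X]).toMonoidHom u⁻¹, rfl⟩
  have hmonic : (r * Polynomial.C (↑u⁻¹ : S)).Monic := by
    rw [Monic, leadingCoeff_mul, leadingCoeff_C, ← hu, u.mul_inv]
  refine ⟨_, ?_, prime_coe_of_isDistinguishedAt (isDistinguishedAt_of_dvd H.isDistinguishedAt hmonic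
    (hassoc.symm.dvd.trans ⟨s, hs⟩)) (hassoc.prime hrp)⟩
  rw [Polynomial.coe_mul]
  exact Ideal.mul_mem_right _ _ hrP

end PowerSeries

namespace MvPowerSeries

open IsLocalRing

instance isDomain {σ R : Type*} [CommRing R] [IsDomain R] : IsDomain (MvPowerSeries σ R) :=
  NoZeroDivisors.to_isDomain _

theorem exists_prime_mem_of_coeff_notMem {R : Type*} [CommRing R] [IsDomain R] [IsLocalRing R]
    {n : ℕ} [UniqueFactorizationMonoid (MvPowerSeries (Fin n) R)]
    [IsAdicComplete (maximalIdeal (MvPowerSeries (Fin n) R)) (MvPowerSeries (Fin n) R)]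
    (P : Ideal (MvPowerSeries (Fin (n + 1)) R)) [P.IsPrime] {f : MvPowerSeries (Fin (n + 1)) R}
    (hf : f ∈ P) {e : Fin (n + 1) →₀ ℕ} (he : coeff e f ∉ maximalIdeal R) : ∃ r ∈ P, Prime r := by
  obtain ⟨d, hd, j, hj⟩ := exists_shear_notMem (maximalIdeal R) f he
  let φ : MvPowerSeries (Fin (n + 1)) R ≃+* PowerSeries (MvPowerSeries (Fin n) R) :=
    (shear d hd).trans (finSuccEquiv R n).toRingEquiv
  have hφ : (φ f).map (residue _) ≠ 0 := by
    intro h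
    have h := congrArg (PowerSeries.coeff j) h
    rw [PowerSeries.coeff_map, map_zero, residue_eq_zero_iff, mem_maximalIdeal, mem_nonunits_iff,
      isUnit_iff_constantCoeff] at h
    exact hj h
  obtain ⟨r, hrP, hr⟩ := PowerSeries.exists_prime_mem_of_map_residue_ne_zero
    (P.comap (φ.symm : _ →+* MvPowerSeries (Fin (n + 1)) R)) (g := φ f)
    (by simpa using hf) hφ
  exact ⟨φ.symm r, hrP, (MulEquiv.prime_iff φ.symm.toMulEquiv).2 hr⟩

theorem uniqueFactorizationMonoid_fin {R : Type*} [CommRing R] [IsDomain R] [IsLocalRing R]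
    [IsNoetherianRing R] [IsAdicComplete (maximalIdeal R) R] [UniqueFactorizationMonoid R] {a : R}
    (ha : Prime a) (hm : maximalIdeal R = Ideal.span {a}) (n : ℕ) :
    UniqueFactorizationMonoid (MvPowerSeries (Fin n) R) := by
  induction n with
  | zero =>
    exact (isEmptyEquiv (Fin 0) R).symm.toMulEquiv.uniqueFactorizationMonoid ‹_›
  | succ n ih =>
    have := isAdicComplete_maximalIdeal (σ := Fin n) hm
    rw [UniqueFactorizationMonoid.iff_exists_prime_mem_of_isPrime]
    intro P hP0 hP
    obtain ⟨f, hfP, hf0⟩ := Submodule.exists_mem_ne_zero_of_ne_bot hP0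
    by_cases haP : C a ∈ P
    · exact ⟨_, haP, prime_C ha⟩
    obtain ⟨k, g, hg, rfl⟩ := WfDvdMonoid.max_power_factor hf0
      (prime_C ha : Prime (C a : MvPowerSeries (Fin (n + 1)) R)).irreducible
    rw [C_dvd_iff, not_forall] at hg
    obtain ⟨e, he⟩ := hg
    exact exists_prime_mem_of_coeff_notMem P
      ((hP.mem_or_mem hfP).resolve_left fun h ↦ haP (hP.mem_of_pow_mem _ h))
      (by rwa [hm, Ideal.mem_span_singleton])

end MvPowerSeries

/-- Approximate division along a dense embedding `ι : A → B`: a multiplier `d ∈ B` carrying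
finitely many elements of `A` into `(f)` is approximated by such multipliers in `A`. -/
theorem exists_dvd_mul_of_map_dvd_mul {A B κ : Type*} [CommRing A] [IsNoetherianRing A]
    [CommRing B] [Finite κ] (ι : A →+* B) (m : Ideal A) {J : ℕ → Ideal B} (hJ : Antitone J)
    (hJm : ∀ k, (J k).comap ι ≤ m ^ k) (hdense : ∀ b k, ∃ a, ι a - b ∈ J k)
    {f : A} {x : κ → A} {d : B} (hd : ∀ j, ι f ∣ d * ι (x j)) (K : ℕ) :
    ∃ a a', (∀ j, f ∣ a * x j) ∧ a - a' ∈ m ^ K ∧ ι a' - d ∈ J K := by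
  cases nonempty_fintype κ
  classical
  let φ : A →ₗ[A] (κ → A ⧸ Ideal.span {f}) :=
    LinearMap.pi fun j ↦ (Ideal.Quotient.mkₐ A (Ideal.span {f})).toLinearMap ∘ₗ
      LinearMap.mulRight A (x j)
  have hφ (a : A) (j : κ) : φ a j = Ideal.Quotient.mk _ (a * x j) := rfl
  obtain ⟨k, hk⟩ := m.exists_pow_inf_eq_pow_smul (LinearMap.range φ)
  obtain ⟨a', ha'⟩ := hdense d (k + K)
  choose b hb using hd
  choose c hc using fun j ↦ hdense (b j) (k + K)
  have hy (j : κ) : a' * x j - f * c j ∈ m ^ (k + K) := by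
    apply hJm
    rw [Ideal.mem_comap, show ι (a' * x j - f * c j) =
      ι (x j) * (ι a' - d) - ι f * (ι (c j) - b j) by
        rw [map_sub, map_mul, map_mul]; linear_combination hb j]
    exact sub_mem (Ideal.mul_mem_left _ _ ha') (Ideal.mul_mem_left _ _ (hc j))
  have hmem : φ a' ∈ m ^ (k + K) • (⊤ : Submodule A (κ → A ⧸ Ideal.span {f})) := by
    have : φ a' = ∑ j, (a' * x j - f * c j) • (Pi.single j 1 : κ → A ⧸ Ideal.span {f}) := by
      ext j
      rw [hφ, Finset.sum_apply, Finset.sum_eq_single j (by simp_all) (by simp)]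
      rw [Pi.smul_apply, Pi.single_eq_same, Algebra.smul_def, mul_one, Ideal.Quotient.algebraMap_eq,
        Ideal.Quotient.mk_eq_mk_iff_sub_mem, Ideal.mem_span_singleton]
      exact ⟨c j, by ring⟩
    rw [this]
    exact sum_mem fun j _ ↦ Submodule.smul_mem_smul (hy j) trivial
  have hmem' : φ a' ∈ Submodule.map φ (m ^ K • (⊤ : Submodule A A)) := by
    have h : φ a' ∈ m ^ (k + K) • ⊤ ⊓ LinearMap.range φ := ⟨hmem, a', rfl⟩
    rw [hk _ le_self_add, Nat.add_sub_cancel_left] at h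
    rw [Submodule.map_smul'', Submodule.map_top]
    exact Submodule.smul_mono le_rfl inf_le_right h
  obtain ⟨t, ht, hta⟩ := hmem'
  refine ⟨a' - t, a', fun j ↦ ?_, ?_, hJ (by omega) ha'⟩
  · have := congrFun (sub_eq_zero.2 hta) j
    rw [← map_sub, hφ, Pi.zero_apply, Ideal.Quotient.eq_zero_iff_mem,
      Ideal.mem_span_singleton] at this
    rw [← dvd_neg, ← neg_mul, neg_sub]
    exact this
  · rw [sub_sub_cancel_left, neg_mem_iff]
    simpa using ht

/-- Local invertibility of the fractional ideal `(f, g)⁻¹`, descended from a unique factorization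
domain in which `A` is dense. -/
theorem exists_mul_eq_mul_notMem {A B : Type*} [CommRing A] [IsDomain A] [IsNoetherianRing A]
    [CommRing B] [IsDomain B] [UniqueFactorizationMonoid B] {ι : A →+* B}
    (hι : Function.Injective ι) {m : Ideal A} (hm : m ≠ ⊤) {J : ℕ → Ideal B} (hJ : Antitone J)
    (hJm : ∀ k, (J k).comap ι ≤ m ^ k) (hdense : ∀ b k, ∃ a, ι a - b ∈ J k)
    {f : A} (hf : f ≠ 0) (g : A) :
    ∃ a b c, f ∣ a * g ∧ (∀ i, f ∣ i * g → f ∣ b * i) ∧ a * b = f * c ∧ c ∉ m := by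
  obtain ⟨K, hK⟩ : ∃ K, f ∉ m ^ K := by
    by_contra! h
    rw [← Submodule.mem_iInf, Ideal.iInf_pow_eq_bot_of_isDomain m hm] at h
    exact hf h
  obtain ⟨f', g', d, hrel, hf', hg'⟩ :=
    UniqueFactorizationMonoid.exists_reduced_factors (ι f) ((map_ne_zero_iff ι hι).2 hf) (ι g)
  have hd0 : d ≠ 0 := by
    rintro rfl
    rw [zero_mul, eq_comm, map_eq_zero_iff ι hι] at hf'
    exact hf hf'
  obtain ⟨S, hS⟩ :=
    IsNoetherian.noetherian (Submodule.comap (LinearMap.mulRight A g) (Ideal.span {f}))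
  have hmemS (i : A) : i ∈ Submodule.span A (S : Set A) ↔ f ∣ i * g := by
    rw [hS, Submodule.mem_comap, Ideal.mem_span_singleton, LinearMap.mulRight_apply]
  obtain ⟨a, a', ha, haa', ha'⟩ := exists_dvd_mul_of_map_dvd_mul ι m hJ hJm hdense
    (x := fun _ : Unit ↦ g) (d := f') (f := f)
    (fun _ ↦ ⟨g', by rw [← hf', ← hg']; ring⟩) K
  obtain ⟨b, b', hb, hbb', hb'⟩ := exists_dvd_mul_of_map_dvd_mul ι m hJ hJm hdense
    (x := fun s : S ↦ (s : A)) (d := d) (f := f)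
    (fun s ↦ by
      have h := map_dvd ι ((hmemS s).1 (Submodule.subset_span s.2))
      rw [map_mul, ← hf', ← hg', mul_left_comm, mul_dvd_mul_iff_left hd0] at h
      rw [← hf', mul_dvd_mul_iff_left hd0]
      exact hrel.dvd_of_dvd_mul_right h) K
  have hbI (i : A) (hi : f ∣ i * g) : f ∣ b * i := by
    have : Submodule.span A (S : Set A) ≤
        Submodule.comap (LinearMap.mulLeft A b) (Ideal.span {f}) :=
      Submodule.span_le.2 fun s hs ↦ by
      rw [SetLike.mem_coe, Submodule.mem_comap, Ideal.mem_span_singleton]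
      exact hb ⟨s, hs⟩
    simpa [Ideal.mem_span_singleton] using this ((hmemS i).2 hi)
  obtain ⟨c, hc⟩ := hbI a (ha ())
  rw [mul_comm] at hc
  refine ⟨a, b, c, ha (), hbI, hc, fun hcm ↦ hK ?_⟩
  have h1 : a' * b' - f ∈ m ^ K := by
    apply hJm
    rw [Ideal.mem_comap, show ι (a' * b' - f) = ι b' * (ι a' - f') + f' * (ι b' - d) by
      rw [map_sub, map_mul, ← hf']; ring]
    exact add_mem (Ideal.mul_mem_left _ _ ha') (Ideal.mul_mem_left _ _ hb')
  have h2 : a * b - f ∈ m ^ K := by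
    rw [show a * b - f = b * (a - a') + a' * (b - b') + (a' * b' - f) by ring]
    exact add_mem (add_mem (Ideal.mul_mem_left _ _ haa') (Ideal.mul_mem_left _ _ hbb')) h1
  have h3 := Ideal.mul_mem_left _ (-∑ i ∈ Finset.range K, c ^ i) h2
  rw [hc, show (-∑ i ∈ Finset.range K, c ^ i) * (f * c - f) =
    f * ((1 - c) * ∑ i ∈ Finset.range K, c ^ i) by ring, mul_neg_geom_sum, mul_sub, mul_one] at h3
  exact (Submodule.sub_mem_iff_left _ (Ideal.mul_mem_left _ _ (Ideal.pow_mem_pow hcm K))).1 h3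

/-- If the ideals `I` and `I'` multiply into `(f)` and, modulo every prime number, some product is
not in the kernel, then some product generates `(f)` up to an element with unit image in `ℤ`. -/
theorem exists_isUnit_of_forall_prime_not_dvd {A : Type*} [CommRing A] [IsDomain A] (χ : A →+* ℤ)
    {I I' : Ideal A} {f : A} (hf : f ≠ 0) (hdvd : ∀ a ∈ I, ∀ b ∈ I', f ∣ a * b)
    (hp : ∀ p : ℕ, p.Prime → ∃ a ∈ I, ∃ b ∈ I', ∃ c, a * b = f * c ∧ ¬ (p : ℤ) ∣ χ c) :
    ∃ a ∈ I, ∃ b ∈ I', ∃ c, a * b = f * c ∧ IsUnit (χ c) := by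
  classical
  have hex : ∃ n : ℕ, n ≠ 0 ∧ ∃ a ∈ I, ∃ b ∈ I', ∃ c, a * b = f * c ∧ (χ c).natAbs = n := by
    obtain ⟨a, ha, b, hb, c, hc, h⟩ := hp 2 Nat.prime_two
    refine ⟨_, fun h0 ↦ h ?_, a, ha, b, hb, c, hc, rfl⟩
    rw [Int.natAbs_eq_zero.1 h0]
    exact dvd_zero _
  obtain ⟨hn0, a₀, ha₀, b₀, hb₀, c₀, hc₀, hcn⟩ := Nat.find_spec hex
  have hc0 : χ c₀ ≠ 0 := by rwa [← Int.natAbs_ne_zero, hcn]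
  have key {a b c : A} (ha : a ∈ I) (hb : b ∈ I') (hc : a * b = f * c)
      (hlt : (χ c).natAbs < (χ c₀).natAbs) : χ c = 0 := by
    by_contra h
    exact Nat.find_min hex (hcn ▸ hlt) ⟨Int.natAbs_ne_zero.2 h, a, ha, b, hb, c, hc, rfl⟩
  have hlt (v : ℤ) : (v - v / χ c₀ * χ c₀).natAbs < (χ c₀).natAbs := by
    rw [mul_comm, ← Int.emod_def]
    have h1 := Int.emod_nonneg v hc0
    have h2 := Int.emod_lt_abs v hc0
    rw [Int.abs_eq_natAbs] at h2
    omega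
  have hl {a c : A} (ha : a ∈ I) (hc : a * b₀ = f * c) : χ c₀ ∣ χ c := by
    have h := key (a := a - (χ c / χ c₀ : ℤ) * a₀) (c := c - (χ c / χ c₀ : ℤ) * c₀)
      (sub_mem ha (Ideal.mul_mem_left _ _ ha₀)) hb₀
      (by linear_combination hc - (χ c / χ c₀ : ℤ) * hc₀)
    rw [map_sub, map_mul, map_intCast, Int.cast_id] at h
    exact ⟨_, (sub_eq_zero.1 (h (hlt _))).trans (mul_comm _ _)⟩
  have hr {b c : A} (hb : b ∈ I') (hc : a₀ * b = f * c) : χ c₀ ∣ χ c := by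
    have h := key (b := b - (χ c / χ c₀ : ℤ) * b₀) (c := c - (χ c / χ c₀ : ℤ) * c₀)
      ha₀ (sub_mem hb (Ideal.mul_mem_left _ _ hb₀))
      (by linear_combination hc - (χ c / χ c₀ : ℤ) * hc₀)
    rw [map_sub, map_mul, map_intCast, Int.cast_id] at h
    exact ⟨_, (sub_eq_zero.1 (h (hlt _))).trans (mul_comm _ _)⟩
  refine ⟨a₀, ha₀, b₀, hb₀, c₀, hc₀, ?_⟩
  by_contra hu
  rw [Int.isUnit_iff_natAbs_eq] at hu
  obtain ⟨p, hpp, hpn⟩ := Nat.exists_prime_and_dvd hu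
  obtain ⟨a, ha, b, hb, c, hc, h⟩ := hp p hpp
  refine h ((Int.natCast_dvd.2 hpn).trans ?_)
  obtain ⟨c₁, hc₁⟩ := hdvd a ha b₀ hb₀
  obtain ⟨c₂, hc₂⟩ := hdvd a₀ ha₀ b hb
  have hcc : c₀ * c = c₁ * c₂ := by
    refine mul_left_cancel₀ (mul_ne_zero hf hf) ?_
    linear_combination -(a * b) * hc₀ - f * c₀ * hc + a₀ * b * hc₁ + f * c₁ * hc₂
  rw [← mul_dvd_mul_iff_left hc0, ← map_mul χ c₀ c, hcc, map_mul]
  exact mul_dvd_mul (hl ha hc₁) (hr hb hc₂)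

namespace MvPowerSeries

variable {σ : Type*}

theorem antitone_adicIdeal {R : Type*} [CommRing R] (a : R) :
    Antitone (adicIdeal σ a) := fun _ _ hjk _ hf e ↦
  (pow_dvd_pow a (Nat.sub_le_sub_right hjk _)).trans (hf e)

theorem comap_adicIdeal_padicInt (p : ℕ) [Fact p.Prime] (k : ℕ) :
    (adicIdeal σ (p : ℤ_[p]) k).comap (map (Int.castRingHom ℤ_[p])) = adicIdeal σ (p : ℤ) k := by
  ext f
  simp only [Ideal.mem_comap, mem_adicIdeal, coeff_map, Int.coe_castRingHom]
  exact forall_congr' fun e ↦ PadicInt.pow_p_dvd_int_iff _ _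

theorem exists_map_sub_mem_adicIdeal_padicInt (p : ℕ) [Fact p.Prime]
    (f : MvPowerSeries σ ℤ_[p]) (k : ℕ) :
    ∃ g : MvPowerSeries σ ℤ, map (Int.castRingHom ℤ_[p]) g - f ∈ adicIdeal σ (p : ℤ_[p]) k := by
  let G : MvPowerSeries σ ℤ := fun e ↦ (PadicInt.appr (coeff e f) k : ℤ)
  refine ⟨G, fun e ↦ (pow_dvd_pow _ (Nat.sub_le k e.degree)).trans ?_⟩
  have h := PadicInt.appr_spec k (coeff e f)
  rw [Ideal.mem_span_singleton] at h
  rw [map_sub, coeff_map, ← dvd_neg, neg_sub]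
  exact_mod_cast h

theorem irreducible_iff_prime_fin_int (n : ℕ) {f : MvPowerSeries (Fin n) ℤ} :
    Irreducible f ↔ Prime f := by
  refine ⟨fun hf ↦ ⟨hf.ne_zero, hf.not_isUnit, fun g k hgk ↦ ?_⟩, Prime.irreducible⟩
  let I : Ideal (MvPowerSeries (Fin n) ℤ) :=
    Submodule.comap (LinearMap.mulRight _ g) (Ideal.span {f})
  have hI (a) : a ∈ I ↔ f ∣ a * g := by
    rw [Submodule.mem_comap, Ideal.mem_span_singleton, LinearMap.mulRight_apply]
  let I' : Ideal (MvPowerSeries (Fin n) ℤ) := (Ideal.span {f}).colon (I : Set _)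
  have hI' (b) : b ∈ I' ↔ ∀ a ∈ I, f ∣ b * a := by
    simp [I', Submodule.mem_colon, Ideal.mem_span_singleton]
  obtain ⟨a, ha, b, hb, c, hc, hu⟩ := exists_isUnit_of_forall_prime_not_dvd
    (constantCoeff : MvPowerSeries (Fin n) ℤ →+* ℤ) (I := I) (I' := I') hf.ne_zero
    (fun a ha b hb ↦ mul_comm b a ▸ (hI' b).1 hb a ha) fun p hp ↦ by
      have : Fact p.Prime := ⟨hp⟩
      have := uniqueFactorizationMonoid_fin (PadicInt.prime_p (p := p))
        PadicInt.maximalIdeal_eq_span_p n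
      obtain ⟨a, b, c, ha, hb, hc, hcm⟩ := exists_mul_eq_mul_notMem
        (ι := map (σ := Fin n) (Int.castRingHom ℤ_[p]))
        (fun x y h ↦ ext fun e ↦ Int.cast_injective (α := ℤ_[p])
          (by simpa using congrArg (coeff e) h))
        (m := adicIdeal (Fin n) (p : ℤ) 1)
        (by
          rw [Ideal.ne_top_iff_one, mem_adicIdeal_one, map_one]
          exact (Nat.prime_iff_prime_int.1 hp).not_dvd_one)
        (antitone_adicIdeal (p : ℤ_[p]))
        (fun k ↦ by rw [comap_adicIdeal_padicInt, adicIdeal_one_pow])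
        (exists_map_sub_mem_adicIdeal_padicInt p) hf.ne_zero g
      exact ⟨a, (hI a).2 ha, b, (hI' b).2 fun i hi ↦ hb i ((hI i).1 hi), c, hc,
        by rwa [mem_adicIdeal_one] at hcm⟩
  obtain ⟨u, rfl⟩ := isUnit_iff_constantCoeff.2 hu
  have hk : k ∈ I := by rwa [hI, mul_comm]
  rcases hf.isUnit_or_isUnit (show f = a * (b * ↑u⁻¹) by
    rw [← mul_assoc, hc, mul_assoc, u.mul_inv, mul_one]) with h | h
  · exact .inl (h.dvd_mul_left.1 ((hI a).1 ha))
  · exact .inr ((isUnit_of_mul_isUnit_left h).dvd_mul_left.1 ((hI' b).1 hb k hk))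

instance uniqueFactorizationMonoid_fin_int (n : ℕ) :
    UniqueFactorizationMonoid (MvPowerSeries (Fin n) ℤ) where
  irreducible_iff_prime := irreducible_iff_prime_fin_int n

end MvPowerSeries

namespace UniqueFactorizationMonoid

variable {A B : Type*} [CommRing A] [UniqueFactorizationMonoid A]
  [CommRing B] [UniqueFactorizationMonoid B]

theorem card_factors_mul {x y : A} (hx : x ≠ 0) (hy : y ≠ 0) :
    (factors (x * y)).card = (factors x).card + (factors y).card := by
  rw [Multiset.card_eq_card_of_rel (factors_mul hx hy), Multiset.card_add]

theorem card_factors_eq_zero_iff {x : A} (hx : x ≠ 0) : (factors x).card = 0 ↔ IsUnit x := by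
  rw [Multiset.card_eq_zero]
  refine ⟨fun h ↦ ?_, fun h ↦ ?_⟩
  · simpa [h, associated_one_iff_isUnit, Associated.comm] using factors_prod hx
  · refine Multiset.eq_zero_of_forall_notMem fun p hp ↦ ?_
    exact (prime_of_factor p hp).not_isUnit (isUnit_of_dvd_unit (dvd_of_mem_factors hp) h)

theorem card_factors_le_card_factors_map (ρ : A →+* B) [IsLocalHom ρ] {x : A} (hx : ρ x ≠ 0) :
    (factors x).card ≤ (factors (ρ x)).card := by
  induction x using induction_on_prime with
  | h₁ => simp at hx
  | h₂ x hu =>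
    have hx0 : x ≠ 0 := by
      rintro rfl
      simp at hx
    simp [(card_factors_eq_zero_iff hx0).2 hu]
  | h₃ x p hx0 hp ih =>
    rw [map_mul] at hx
    have hρp := left_ne_zero_of_mul hx
    have hρx := right_ne_zero_of_mul hx
    have : (factors (ρ p)).card ≠ 0 := by
      rw [Ne, card_factors_eq_zero_iff hρp, isUnit_map_iff]
      exact hp.not_isUnit
    rw [map_mul, card_factors_mul hp.ne_zero hx0, card_factors_mul hρp hρx,
      card_factors_of_irreducible hp.irreducible]
    exact add_le_add (Nat.one_le_iff_ne_zero.2 this) (ih hρx)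

theorem exists_prime_map_eq (ρ : A →+* B) [IsLocalHom ρ] (hρ : Function.Surjective ρ) {x : A}
    (hx : ρ x ≠ 0) (hcard : (factors x).card = (factors (ρ x)).card) {q : B} (hq : Prime q)
    (hqx : q ∣ ρ x) : ∃ p, Prime p ∧ p ∣ x ∧ ρ p = q := by
  have hx0 : x ≠ 0 := by
    rintro rfl
    simp at hx
  obtain ⟨p, hp, hqp⟩ : ∃ p ∈ factors x, q ∣ ρ p := by
    refine hq.exists_mem_multiset_map_dvd ?_
    refine hqx.trans ?_
    rw [← map_multiset_prod]
    exact map_dvd ρ (factors_prod hx0).symm.dvd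
  have hpp := prime_of_factor p hp
  obtain ⟨y, rfl⟩ := dvd_of_mem_factors hp
  obtain ⟨z, hz⟩ := hqp
  have hy0 := right_ne_zero_of_mul hx0
  rw [map_mul] at hx hcard
  have hρy := right_ne_zero_of_mul hx
  have hqz := left_ne_zero_of_mul hx
  rw [hz] at hqz
  have hz0 := right_ne_zero_of_mul hqz
  have hzu : IsUnit z := by
    rw [← card_factors_eq_zero_iff hz0]
    have := card_factors_le_card_factors_map ρ hρy
    rw [card_factors_mul hpp.ne_zero hy0, hz, card_factors_mul hqz hρy,
      card_factors_mul hq.ne_zero hz0, card_factors_of_irreducible hpp.irreducible,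
      card_factors_of_irreducible hq.irreducible] at hcard
    omega
  obtain ⟨v, hv⟩ := hρ ↑hzu.unit⁻¹
  have hvu : IsUnit v := by
    rw [← isUnit_map_iff ρ, hv]
    exact Units.isUnit _
  have hassoc : Associated p (p * v) := ⟨hvu.unit, rfl⟩
  refine ⟨p * v, hassoc.prime hpp, hassoc.symm.dvd.trans (dvd_mul_right p y), ?_⟩
  rw [map_mul, hz, hv, mul_assoc, hzu.mul_val_inv, mul_one]

end UniqueFactorizationMonoid

section InverseLimit

open UniqueFactorizationMonoid

variable {D : Type*} [CommRing D] {A : ℕ → Type*} [∀ n, CommRing (A n)]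
  [∀ n, IsDomain (A n)] {π : ∀ n, D →+* A n} {ρ : ∀ n, A (n + 1) →+* A n}

theorem dvd_of_forall_map_dvd (hπ : ∀ n x, ρ n (π (n + 1) x) = π n x)
    (hinj : ∀ x y, (∀ n, π n x = π n y) → x = y)
    (hlift : ∀ a : ∀ n, A n, (∀ n, ρ n (a (n + 1)) = a n) → ∃ x, ∀ n, π n x = a n)
    {x y : D} (hx : ∀ n, π n x ≠ 0) (h : ∀ n, π n x ∣ π n y) : x ∣ y := by
  choose q hq using h
  obtain ⟨z, hz⟩ := hlift q fun n ↦ mul_left_cancel₀ (hx n) <| by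
    rw [← hq, ← hπ n x, ← map_mul, ← hq, hπ]
  exact ⟨z, hinj _ _ fun n ↦ by rw [map_mul, hz, hq]⟩

theorem prime_of_forall_prime_map (hπ : ∀ n x, ρ n (π (n + 1) x) = π n x)
    (hinj : ∀ x y, (∀ n, π n x = π n y) → x = y)
    (hlift : ∀ a : ∀ n, A n, (∀ n, ρ n (a (n + 1)) = a n) → ∃ x, ∀ n, π n x = a n)
    {x : D} (hx : ∀ n, Prime (π n x)) : Prime x := by
  refine ⟨fun h ↦ (hx 0).ne_zero (by rw [h, map_zero]),
    fun h ↦ (hx 0).not_isUnit (h.map _), fun y z hyz ↦ ?_⟩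
  have hmono (w : D) {m n : ℕ} (hmn : m ≤ n) (h : π n x ∣ π n w) : π m x ∣ π m w := by
    induction n, hmn using Nat.le_induction with
    | base => exact h
    | succ n _ ih =>
      apply ih
      rw [← hπ n x, ← hπ n w]
      exact map_dvd _ h
  by_contra! hcon
  have hex (w : D) (hw : ¬ x ∣ w) : ∃ n, ¬ π n x ∣ π n w := by
    by_contra! h
    exact hw (dvd_of_forall_map_dvd hπ hinj hlift (fun n ↦ (hx n).ne_zero) h)
  obtain ⟨i, hi⟩ := hex y hcon.1
  obtain ⟨j, hj⟩ := hex z hcon.2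
  have hij := map_dvd (π (max i j)) hyz
  rw [map_mul] at hij
  rcases (hx _).dvd_or_dvd hij with h | h
  · exact hi (hmono y (le_max_left i j) h)
  · exact hj (hmono z (le_max_right i j) h)

variable [∀ n, UniqueFactorizationMonoid (A n)]

theorem exists_prime_dvd_of_card_factors_eq [∀ n, IsLocalHom (π n)] [∀ n, IsLocalHom (ρ n)]
    (hπ : ∀ n x, ρ n (π (n + 1) x) = π n x) (hρ : ∀ n, Function.Surjective (ρ n))
    (hinj : ∀ x y, (∀ n, π n x = π n y) → x = y)
    (hlift : ∀ a : ∀ n, A n, (∀ n, ρ n (a (n + 1)) = a n) → ∃ x, ∀ n, π n x = a n)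
    {x : D} (hx : ∀ n, π n x ≠ 0) (hu : ¬ IsUnit x)
    (hcard : ∀ n, (factors (π (n + 1) x)).card = (factors (π n x)).card) :
    ∃ d, Prime d ∧ d ∣ x := by
  obtain ⟨p₀, hp₀, hpx₀⟩ := WfDvdMonoid.exists_irreducible_factor
    (mt (isUnit_map_iff (π 0) x).1 hu) (hx 0)
  have hstep (n : ℕ) (q : {q : A n // Prime q ∧ q ∣ π n x}) :
      ∃ p : {p : A (n + 1) // Prime p ∧ p ∣ π (n + 1) x}, ρ n p = q := by
    obtain ⟨p, hp, hpx, hpq⟩ := exists_prime_map_eq (ρ n) (hρ n) (x := π (n + 1) x)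
      (by rw [hπ]; exact hx n) (by rw [hπ, hcard]) q.2.1 (by rw [hπ]; exact q.2.2)
    exact ⟨⟨p, hp, hpx⟩, hpq⟩
  choose next hnext using hstep
  let P (n : ℕ) : {p : A n // Prime p ∧ p ∣ π n x} :=
    Nat.rec ⟨p₀, hp₀.prime, hpx₀⟩ next n
  obtain ⟨d, hd⟩ := hlift (fun n ↦ (P n).1) fun n ↦ hnext n (P n)
  exact ⟨d, prime_of_forall_prime_map hπ hinj hlift fun n ↦ hd n ▸ (P n).2.1,
    dvd_of_forall_map_dvd hπ hinj hlift (fun n ↦ hd n ▸ (P n).2.1.ne_zero)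
      fun n ↦ hd n ▸ (P n).2.2⟩

theorem uniqueFactorizationMonoid_of_inverseLimit [IsDomain D]
    [∀ n, IsLocalHom (π n)] [∀ n, IsLocalHom (ρ n)]
    (hπ : ∀ n x, ρ n (π (n + 1) x) = π n x) (hρ : ∀ n, Function.Surjective (ρ n))
    (hinj : ∀ N x y, (∀ k, π (N + k) x = π (N + k) y) → x = y)
    (hlift : ∀ N, ∀ a : ∀ k, A (N + k), (∀ k, ρ (N + k) (a (k + 1)) = a k) →
      ∃ x, ∀ k, π (N + k) x = a k) :
    UniqueFactorizationMonoid D := by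
  have hstable (N : ℕ) (x : D) (hx : π N x ≠ 0) (k : ℕ) : π (N + k) x ≠ 0 := by
    induction k with
    | zero => exact hx
    | succ k ih =>
      intro h
      apply ih
      rw [← hπ]
      exact (congrArg (ρ (N + k)) h).trans (map_zero _)
  have hdvd (N : ℕ) (x : D) (hx : π N x ≠ 0) (hu : ¬ IsUnit x) : ∃ d, Prime d ∧ d ∣ x := by
    have hanti : Antitone fun k ↦ (factors (π (N + k) x)).card := antitone_nat_of_succ_le fun k ↦ by
      have h := card_factors_le_card_factors_map (ρ (N + k)) (x := π (N + k + 1) x)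
        (by rw [hπ]; exact hstable N x hx k)
      rwa [hπ] at h
    obtain ⟨k₀, hk₀⟩ : ∃ k₀, ∀ k, (factors (π (N + k₀) x)).card ≤ (factors (π (N + k) x)).card :=
      ⟨_, fun k ↦ Function.argmin_le (fun k ↦ (factors (π (N + k) x)).card) k⟩
    have hconst (k : ℕ) : (factors (π (N + k₀ + k) x)).card = (factors (π (N + k₀) x)).card := by
      rw [add_assoc]
      exact le_antisymm (hanti (Nat.le_add_right _ _)) (hk₀ _)
    refine exists_prime_dvd_of_card_factors_eq (A := fun k ↦ A (N + k₀ + k))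
      (π := fun k ↦ π (N + k₀ + k)) (ρ := fun k ↦ ρ (N + k₀ + k)) (fun k ↦ hπ _) (fun k ↦ hρ _)
      (hinj _) (hlift _) (fun k ↦ ?_) hu fun k ↦ (hconst (k + 1)).trans (hconst k).symm
    rw [add_assoc]
    exact hstable N x hx _
  refine UniqueFactorizationMonoid.of_exists_prime_factors fun x hx ↦ ?_
  obtain ⟨N, hN⟩ : ∃ N, π N x ≠ 0 := by
    by_contra! h
    exact hx (hinj 0 _ _ fun k ↦ by rw [h, map_zero])
  induction hl : (factors (π N x)).card using Nat.strong_induction_on generalizing x with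
  | _ l ih =>
    by_cases hu : IsUnit x
    · exact ⟨0, by simp, by simpa [Associated.comm, associated_one_iff_isUnit] using hu⟩
    obtain ⟨d, hd, y, rfl⟩ := hdvd N x hN hu
    rw [map_mul] at hN hl
    have hNd := left_ne_zero_of_mul hN
    have hNy := right_ne_zero_of_mul hN
    have : (factors (π N d)).card ≠ 0 := by
      rw [Ne, card_factors_eq_zero_iff hNd, isUnit_map_iff]
      exact hd.not_isUnit
    rw [card_factors_mul hNd hNy] at hl
    obtain ⟨s, hs, hsy⟩ := ih _ (by omega) y (right_ne_zero_of_mul hx) hNy rfl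
    refine ⟨d ::ₘ s, by simpa [hd] using hs, ?_⟩
    rw [Multiset.prod_cons]
    exact hsy.mul_left d

end InverseLimit

namespace MvPowerSeries

theorem isLocalHom_killCompl {σ τ R : Type*} [CommRing R] (e : σ ↪ τ) :
    IsLocalHom (killCompl (R := R) e : MvPowerSeries τ R →+* MvPowerSeries σ R) where
  map_nonunit f hf := by
    rw [isUnit_iff_constantCoeff, ← coeff_zero_eq_constantCoeff_apply] at hf ⊢
    simpa [coeff_killCompl] using hf

theorem killCompl_killCompl {σ τ υ R : Type*} [CommRing R] (e : σ ↪ τ) (e' : τ ↪ υ)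
    (f : MvPowerSeries υ R) : killCompl e (killCompl e' f) = killCompl (e.trans e') f := by
  ext x
  rw [coeff_killCompl, coeff_killCompl, coeff_killCompl, Finsupp.embDomain_trans_apply]

theorem exists_killCompl_eq {R : Type*} [CommRing R] (N : ℕ)
    (a : ∀ k, MvPowerSeries (Fin (N + k)) R)
    (ha : ∀ k, killCompl Fin.castSuccEmb (a (k + 1)) = a k) :
    ∃ f : MvPowerSeries ℕ R, ∀ k, killCompl Fin.valEmbedding f = a k := by
  let c (k : ℕ) (e : ℕ →₀ ℕ) : R :=
    coeff (e.comapDomain (Fin.val : Fin (N + k) → ℕ) Fin.val_injective.injOn) (a k)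
  have hc {k l : ℕ} {e : ℕ →₀ ℕ} (he : ∀ i, N + k ≤ i → e i = 0) (hkl : k ≤ l) : c l e = c k e := by
    induction l, hkl using Nat.le_induction with
    | base => rfl
    | succ l hkl ih =>
      rw [← ih]
      simp only [c]
      rw [← ha l, coeff_killCompl]
      congr 2
      ext i
      induction i using Fin.lastCases with
      | last =>
        rw [Finsupp.comapDomain_apply, Finsupp.embDomain_of_notMem_range]
        · exact he _ (by simp; omega)
        · rintro ⟨i, hi⟩
          exact Fin.castSucc_ne_last i hi
      | cast i =>
        exact (Finsupp.embDomain_apply_self Fin.castSuccEmb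
          (e.comapDomain (Fin.val : Fin (N + l) → ℕ) Fin.val_injective.injOn) i).symm
  let K (e : ℕ →₀ ℕ) : ℕ := e.support.sup id + 1
  have hK (e : ℕ →₀ ℕ) (i : ℕ) (hi : N + K e ≤ i) : e i = 0 := by
    by_contra h
    have := Finset.le_sup (f := id) (Finsupp.mem_support_iff.2 h)
    simp only [K, id] at *
    omega
  let F : MvPowerSeries ℕ R := fun e ↦ c (K e) e
  refine ⟨F, fun k ↦ ?_⟩
  ext x
  rw [coeff_killCompl]
  have hx (i : ℕ) (hi : N + k ≤ i) : Finsupp.embDomain Fin.valEmbedding x i = 0 := by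
    refine Finsupp.embDomain_of_notMem_range _ _ _ ?_
    rintro ⟨j, rfl⟩
    exact absurd hi j.2.not_ge
  change c _ _ = _
  rw [← hc (hK _) (le_max_left _ k), hc hx (le_max_right _ _)]
  simp only [c]
  congr 2
  ext i
  exact Finsupp.embDomain_apply_self Fin.valEmbedding x i

theorem ext_killCompl {R : Type*} [CommRing R] (N : ℕ) {f g : MvPowerSeries ℕ R}
    (h : ∀ k, killCompl (Fin.valEmbedding (n := N + k)) f = killCompl Fin.valEmbedding g) :
    f = g := by
  ext e
  obtain ⟨x, hx⟩ : e ∈ Set.range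
      (Finsupp.embDomain (Fin.valEmbedding (n := N + (e.support.sup id + 1))) (M := ℕ)) := by
    rw [Finsupp.mem_range_embDomain_iff]
    intro i hi
    have := Finset.le_sup (f := id) hi
    exact ⟨⟨i, by simp only [id] at this; omega⟩, rfl⟩
  have := congrArg (coeff x) (h _)
  rwa [coeff_killCompl, coeff_killCompl, hx] at this

instance uniqueFactorizationMonoid_nat_int :
    UniqueFactorizationMonoid (MvPowerSeries ℕ ℤ) :=
  let π (n : ℕ) : MvPowerSeries ℕ ℤ →+* MvPowerSeries (Fin n) ℤ :=
    killCompl (R := ℤ) (Fin.valEmbedding (n := n))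
  let ρ (n : ℕ) : MvPowerSeries (Fin (n + 1)) ℤ →+* MvPowerSeries (Fin n) ℤ :=
    killCompl (R := ℤ) (Fin.castSuccEmb (n := n))
  have (n : ℕ) : IsLocalHom (π n) := isLocalHom_killCompl _
  have (n : ℕ) : IsLocalHom (ρ n) := isLocalHom_killCompl _
  uniqueFactorizationMonoid_of_inverseLimit (A := fun n ↦ MvPowerSeries (Fin n) ℤ) (π := π) (ρ := ρ)
    (fun _ f ↦ killCompl_killCompl Fin.castSuccEmb Fin.valEmbedding f)
    (fun _ f ↦ ⟨rename Fin.castSuccEmb f, killCompl_rename_app f⟩)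
    (fun N _ _ h ↦ ext_killCompl N h)
    (fun N a ha ↦ exists_killCompl_eq N a ha)

end MvPowerSeries

/-- The multiplicative bijection between exponent vectors and positive integers. -/
noncomputable def primesFinsuppEquivPNat : (Nat.Primes →₀ ℕ) ≃ ℕ+ :=
  Multiset.toFinsupp.symm.toEquiv.trans PNat.factorMultisetEquiv.symm

theorem primesFinsuppEquivPNat_add (d e : Nat.Primes →₀ ℕ) :
    primesFinsuppEquivPNat (d + e) = primesFinsuppEquivPNat d * primesFinsuppEquivPNat e :=
  (congrArg PrimeMultiset.prod (map_add Multiset.toFinsupp.symm d e)).trans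
    (PrimeMultiset.prod_add _ _)

theorem primesFinsuppEquivPNat_zero : primesFinsuppEquivPNat 0 = 1 :=
  (congrArg PrimeMultiset.prod (map_zero Multiset.toFinsupp.symm)).trans PrimeMultiset.prod_zero

namespace ArithmeticFunction

variable {R : Type*} [CommRing R]

/-- The Bell series of an arithmetic function, in one variable for each prime number. -/
noncomputable def bellSeries (α : ArithmeticFunction R) : MvPowerSeries Nat.Primes R :=
  fun e ↦ α (primesFinsuppEquivPNat e)

theorem coeff_bellSeries (α : ArithmeticFunction R) (e : Nat.Primes →₀ ℕ) :
    MvPowerSeries.coeff e (bellSeries α) = α (primesFinsuppEquivPNat e) :=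
  rfl

/-- The Bell series as a ring homomorphism. -/
noncomputable def toMvPowerSeries : ArithmeticFunction R →+* MvPowerSeries Nat.Primes R where
  toFun := bellSeries
  map_zero' := rfl
  map_add' _ _ := rfl
  map_one' := by
    classical
    ext e
    rw [MvPowerSeries.coeff_one, coeff_bellSeries, one_apply]
    congr 1
    rw [PNat.coe_eq_one_iff, ← primesFinsuppEquivPNat_zero, EmbeddingLike.apply_eq_iff_eq]
  map_mul' α β := by
    classical
    ext e
    rw [MvPowerSeries.coeff_mul, coeff_bellSeries, mul_apply]
    symm
    refine Finset.sum_bij (fun x _ ↦ ((primesFinsuppEquivPNat x.1 : ℕ),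
      (primesFinsuppEquivPNat x.2 : ℕ))) (fun x hx ↦ ?_) (fun x _ y _ hxy ↦ ?_) (fun x hx ↦ ?_)
      (fun x _ ↦ rfl)
    · rw [Finset.HasAntidiagonal.mem_antidiagonal] at hx
      rw [Nat.mem_divisorsAntidiagonal, ← hx, primesFinsuppEquivPNat_add]
      exact ⟨rfl, PNat.ne_zero _⟩
    · simpa [Prod.ext_iff] using hxy
    · obtain ⟨m, n⟩ := x
      rw [Nat.mem_divisorsAntidiagonal] at hx
      obtain ⟨h, h0⟩ := hx
      dsimp only at h
      rw [← h, mul_ne_zero_iff] at h0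
      obtain ⟨a, ha⟩ := primesFinsuppEquivPNat.surjective ⟨m, Nat.pos_of_ne_zero h0.1⟩
      obtain ⟨b, hb⟩ := primesFinsuppEquivPNat.surjective ⟨n, Nat.pos_of_ne_zero h0.2⟩
      refine ⟨(a, b), ?_, by simp [ha, hb]⟩
      rw [Finset.HasAntidiagonal.mem_antidiagonal]
      apply primesFinsuppEquivPNat.injective
      rw [primesFinsuppEquivPNat_add, ha, hb]
      exact PNat.eq h

theorem toMvPowerSeries_bijective : Function.Bijective (toMvPowerSeries (R := R)) := by
  constructor
  · intro α β h
    ext n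
    rcases Nat.eq_zero_or_pos n with rfl | hn
    · rw [map_zero, map_zero]
    · obtain ⟨e, he⟩ := primesFinsuppEquivPNat.surjective ⟨n, hn⟩
      have h' : α (primesFinsuppEquivPNat e) = β (primesFinsuppEquivPNat e) :=
        congrArg (MvPowerSeries.coeff e) h
      rwa [he] at h'
  · intro f
    refine ⟨⟨fun n ↦ if h : 0 < n then
      MvPowerSeries.coeff (primesFinsuppEquivPNat.symm ⟨n, h⟩) f else 0, by simp⟩, ?_⟩
    ext e
    change (if h : 0 < (primesFinsuppEquivPNat e : ℕ) then
      MvPowerSeries.coeff (primesFinsuppEquivPNat.symm ⟨primesFinsuppEquivPNat e, h⟩) f else 0) = _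
    rw [dif_pos (PNat.pos _)]
    exact congrArg (fun e ↦ MvPowerSeries.coeff e f) (primesFinsuppEquivPNat.symm_apply_apply e)

instance uniqueFactorizationMonoid_int : UniqueFactorizationMonoid (ArithmeticFunction ℤ) := by
  have : Infinite Nat.Primes := Nat.infinite_setOfPred_prime.to_subtype
  obtain ⟨e⟩ := nonempty_equiv_of_countable (α := ℕ) (β := Nat.Primes)
  have : UniqueFactorizationMonoid (MvPowerSeries Nat.Primes ℤ) :=
    (MvPowerSeries.renameEquiv (R := ℤ) e).toMulEquiv.uniqueFactorizationMonoid inferInstance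
  let E := RingEquiv.ofBijective _ (toMvPowerSeries_bijective (R := ℤ))
  exact E.symm.toMulEquiv.uniqueFactorizationMonoid this

end ArithmeticFunction

/-- The ring of arithmetic functions with integer values is a unique factorization domain:
every nonzero element is a unit times a finite product of irreducibles, and this
representation is unique up to order and replacement of factors by associates. -/
theorem stmt_11 :
    (∀ α : ArithmeticFunction ℤ, α ≠ 0 →
      ∃ (u : (ArithmeticFunction ℤ)ˣ) (s : Multiset (ArithmeticFunction ℤ)),
        (∀ π ∈ s, Irreducible π) ∧ (u : ArithmeticFunction ℤ) * s.prod = α) ∧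
    (∀ (u v : (ArithmeticFunction ℤ)ˣ) (s t : Multiset (ArithmeticFunction ℤ)),
      (∀ π ∈ s, Irreducible π) → (∀ π ∈ t, Irreducible π) →
      (u : ArithmeticFunction ℤ) * s.prod = (v : ArithmeticFunction ℤ) * t.prod →
      Multiset.Rel Associated s t) := by
  refine ⟨fun α hα ↦ ?_, fun u v s t hs ht h ↦ ?_⟩
  · obtain ⟨s, hs, u, hu⟩ := WfDvdMonoid.exists_factors α hα
    exact ⟨u, s, hs, by rw [mul_comm, hu]⟩
  · refine UniqueFactorizationMonoid.factors_unique hs ht ?_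
    exact (associated_unit_mul_left _ _ u.isUnit).symm.trans
      (h ▸ associated_unit_mul_left _ _ v.isUnit)
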